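/- Let A be a complete deterministic finite automaton over a finite alphabet with finite state set, transition graph Γ and transition semigroup S. Suppose that (1) for every C-node (p,q) of Γ² with p ⪰ q and q ⪰ p one has p = q, and (2) for every C-node (p,q) of Γ² with p ⪰ q and every s ∈ S, p·s ⪰ q if and only if q·s ⪰ q. Then for every idempotent e ∈ S the subsemigroup eSe is commutative: for all a, b ∈ S, (eae)(ebe) = (ebe)(eae) (equality of transformations of the state set). -/

import Mathlib

/-- Extended transition function of a DFA. -/
def deltaStar {Q A : Type*} (δ : Q → A → Q) (q : Q) (w : List A) : Q :=
  w.foldl δ q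

/-- `p ⪰ q` : the state `q` is reachable from `p`. -/
def Reach {Q A : Type*} (δ : Q → A → Q) (p q : Q) : Prop :=
  ∃ w : List A, deltaStar δ p w = q

/-- `(p, q)` is a C-node of `Γ²`: some nonempty word fixes both `p` and `q`. -/
def CNode {Q A : Type*} (δ : Q → A → Q) (p q : Q) : Prop :=
  ∃ w : List A, w ≠ [] ∧ deltaStar δ p w = p ∧ deltaStar δ q w = q

/-- The transition semigroup of a DFA: transformations of the state set
induced by nonempty words.  For `f` in the semigroup, `p·f = f p`, and the
semigroup product `f*g` is the composite `g ∘ f`. -/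
def TransSemigroup {Q A : Type*} (δ : Q → A → Q) : Set (Q → Q) :=
  {f | ∃ w : List A, w ≠ [] ∧ ∀ q, f q = deltaStar δ q w}

theorem deltaStar_append {Q A : Type*} (δ : Q → A → Q) (q : Q) (u v : List A) :
    deltaStar δ q (u ++ v) = deltaStar δ (deltaStar δ q u) v :=
  List.foldl_append

theorem Reach.refl {Q A : Type*} (δ : Q → A → Q) (p : Q) : Reach δ p p :=
  ⟨[], rfl⟩

theorem Reach.trans {Q A : Type*} {δ : Q → A → Q} {p q r : Q}
    (hpq : Reach δ p q) (hqr : Reach δ q r) : Reach δ p r := by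
  obtain ⟨u, rfl⟩ := hpq
  obtain ⟨v, rfl⟩ := hqr
  exact ⟨u ++ v, deltaStar_append δ p u v⟩

theorem TransSemigroup.reach {Q A : Type*} {δ : Q → A → Q} {f : Q → Q}
    (hf : f ∈ TransSemigroup δ) (p : Q) : Reach δ p (f p) := by
  obtain ⟨w, -, hw⟩ := hf
  exact ⟨w, (hw p).symm⟩

theorem TransSemigroup.comp_mem {Q A : Type*} {δ : Q → A → Q} {f g : Q → Q}
    (hf : f ∈ TransSemigroup δ) (hg : g ∈ TransSemigroup δ) : f ∘ g ∈ TransSemigroup δ := by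
  obtain ⟨u, -, hu⟩ := hf
  obtain ⟨v, hv, hv'⟩ := hg
  refine ⟨v ++ u, by simp [hv], fun q => ?_⟩
  rw [deltaStar_append, ← hv', ← hu, Function.comp_apply]

theorem TransSemigroup.cNode {Q A : Type*} {δ : Q → A → Q} {e : Q → Q}
    (he : e ∈ TransSemigroup δ) {p q : Q} (hp : e p = p) (hq : e q = q) : CNode δ p q := by
  obtain ⟨w, hw, h⟩ := he
  exact ⟨w, hw, (h p).symm.trans hp, (h q).symm.trans hq⟩

/-- Under the graph conditions, if `p` reaches `q` and `f p` reaches `q`, with `q` and `f q`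
both fixed by the transformation `e`, then `f` fixes `q`. -/
theorem fixed_of_reach_apply {Q A : Type*} {δ : Q → A → Q}
    (h1 : ∀ p q : Q, CNode δ p q → Reach δ p q → Reach δ q p → p = q)
    (h2 : ∀ p q : Q, CNode δ p q → Reach δ p q →
      ∀ f ∈ TransSemigroup δ, (Reach δ (f p) q ↔ Reach δ (f q) q))
    {e f : Q → Q} (he : e ∈ TransSemigroup δ) (hf : f ∈ TransSemigroup δ)
    {p q : Q} (hp : e p = p) (hq : e q = q) (hfq : e (f q) = f q)
    (hpq : Reach δ p q) (hfp : Reach δ (f p) q) : f q = q :=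
  h1 _ _ (TransSemigroup.cNode he hfq hq)
    ((h2 p q (TransSemigroup.cNode he hp hq) hpq f hf).1 hfp) (TransSemigroup.reach hf q)

/-- Under the graph conditions, `f (g p)` is reachable from `g (f p)` whenever `f` and `g` take
values in the fixed points of `e` and `p` is such a fixed point. -/
theorem reach_apply_swap {Q A : Type*} {δ : Q → A → Q}
    (h1 : ∀ p q : Q, CNode δ p q → Reach δ p q → Reach δ q p → p = q)
    (h2 : ∀ p q : Q, CNode δ p q → Reach δ p q →
      ∀ f ∈ TransSemigroup δ, (Reach δ (f p) q ↔ Reach δ (f q) q))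
    {e f g : Q → Q} (he : e ∈ TransSemigroup δ) (hf : f ∈ TransSemigroup δ)
    (hg : g ∈ TransSemigroup δ) (hef : ∀ x, e (f x) = f x) (heg : ∀ x, e (g x) = g x)
    {p : Q} (hp : e p = p) : Reach δ (g (f p)) (f (g p)) := by
  have hgq : Reach δ (g p) (f (g p)) := TransSemigroup.reach hf _
  have hpq : Reach δ p (f (g p)) := (TransSemigroup.reach hg p).trans hgq
  have hf_fix : f (f (g p)) = f (g p) :=
    fixed_of_reach_apply h1 h2 he hf (heg p) (hef _) (hef _) hgq (Reach.refl δ _)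
  have hg_fix : g (f (g p)) = f (g p) :=
    fixed_of_reach_apply h1 h2 he hg hp (hef _) (heg _) hpq hgq
  refine (h2 p _ (TransSemigroup.cNode he hp (hef _)) hpq (g ∘ f)
    (TransSemigroup.comp_mem hg hf)).2 ?_
  rw [Function.comp_apply, hf_fix, hg_fix]
  exact Reach.refl δ _

/-- If (1) every C-node `(p,q)` of `Γ²` with `p ⪰ q` and `q ⪰ p` satisfies `p = q`
and (2) for every C-node `(p,q)` of `Γ²` with `p ⪰ q` and every `s ∈ S` one has
`p·s ⪰ q ↔ q·s ⪰ q`, then for every idempotent `e ∈ S` the subsemigroup `eSe`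
is commutative: `(eae)(ebe) = (ebe)(eae)` as transformations of the state set. -/
theorem eSe_commutative_of_graph_conditions
    {Q A : Type*} [Fintype Q] [Fintype A] (δ : Q → A → Q)
    (h1 : ∀ p q : Q, CNode δ p q → Reach δ p q → Reach δ q p → p = q)
    (h2 : ∀ p q : Q, CNode δ p q → Reach δ p q →
      ∀ f ∈ TransSemigroup δ, (Reach δ (f p) q ↔ Reach δ (f q) q)) :
    ∀ e ∈ TransSemigroup δ, e ∘ e = e →
      ∀ a ∈ TransSemigroup δ, ∀ b ∈ TransSemigroup δ,
        (e ∘ a ∘ e) ∘ (e ∘ b ∘ e) = (e ∘ b ∘ e) ∘ (e ∘ a ∘ e) := by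
  intro e he hee a ha b hb
  have hidem : ∀ x, e (e x) = e x := congrFun hee
  have hmem : ∀ c ∈ TransSemigroup δ, e ∘ c ∘ e ∈ TransSemigroup δ := fun c hc =>
    TransSemigroup.comp_mem he (TransSemigroup.comp_mem hc he)
  have hfix : ∀ (c : Q → Q) (x : Q), e ((e ∘ c ∘ e) x) = (e ∘ c ∘ e) x := fun c x => hidem _
  funext x
  have hcomm := h1 _ _ (TransSemigroup.cNode he (hfix a _) (hfix b _))
    (reach_apply_swap h1 h2 he (hmem b hb) (hmem a ha) (hfix b) (hfix a) (hidem x))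
    (reach_apply_swap h1 h2 he (hmem a ha) (hmem b hb) (hfix a) (hfix b) (hidem x))
  simpa only [Function.comp_apply, hidem] using hcomm
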